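/- For every node u in a planning instance with bias b > 1, if the reward placed at t is at least b · C_o(u), then u is motivated (never abandoned). In particular, the graph is traversable for every reward R ≥ b · C_o(s), so the minimal reward R^min(G) required to motivate a sophisticated agent to reach t satisfies R^min(G) ≤ b · C_o(s). -/

import Mathlib

/-- `IsPathTo E t u l`: `l` lists the successive vertices strictly after `u`
on a directed path from `u` to `t` along edges of `E`. -/
def IsPathTo {n : ℕ} (E : Fin n → Fin n → Prop) (t : Fin n) :
    Fin n → List (Fin n) → Prop
  | u, [] => u = t
  | u, v :: l => E u v ∧ IsPathTo E t v l

/-- Total cost (or reward) of the path from `u` along the vertex list `l`. -/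
def pathCost {n : ℕ} (c : Fin n → Fin n → ℝ) : Fin n → List (Fin n) → ℝ
  | _, [] => 0
  | u, v :: l => c u v + pathCost c v l

/-- A planning instance: a finite DAG on `Fin n` (the order on `Fin n` is a
topological order, which is WLOG for finite DAGs), nonnegative edge costs,
a source `s` and a target `t` that is reachable from every node. -/
structure PlanningInstance (n : ℕ) where
  E : Fin n → Fin n → Prop
  c : Fin n → Fin n → ℝ
  s : Fin n
  t : Fin n
  edge_lt : ∀ u v, E u v → u < v
  c_nonneg : ∀ u v, E u v → 0 ≤ c u v
  reach : ∀ u, ∃ l, IsPathTo E t u l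

/-- `Co u` is the minimum total cost of a directed path from `u` to the target. -/
def IsOptCost {n : ℕ} (G : PlanningInstance n) (Co : Fin n → ℝ) : Prop :=
  ∀ u, IsLeast {x : ℝ | ∃ l, IsPathTo G.E G.t u l ∧ pathCost G.c u l = x} (Co u)

/-- Motivated set `M` and pruned sophisticated cost `C`, for bias `b` and a
reward `R` placed at the target, over the edge relation `E'`: `t` is motivated
with `C t = 0`; a node `u ≠ t` is motivated iff some edge `(u,v)` has `v`
motivated and perceived cost `b·c(u,v) + C v ≤ R`, in which case `C u` follows
a minimizer of `b·c(u,v) + C v` over such edges. -/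
structure RewardSpecOn {n : ℕ} (G : PlanningInstance n)
    (E' : Fin n → Fin n → Prop) (b R : ℝ)
    (M : Fin n → Prop) (C : Fin n → ℝ) : Prop where
  m_t : M G.t
  c_t : C G.t = 0
  m_iff : ∀ u, u ≠ G.t →
    (M u ↔ ∃ v, E' u v ∧ M v ∧ b * G.c u v + C v ≤ R)
  c_min : ∀ u, u ≠ G.t → M u →
    ∃ v, E' u v ∧ M v ∧ b * G.c u v + C v ≤ R ∧ C u = G.c u v + C v ∧
      (∀ w, E' u w → M w → b * G.c u w + C w ≤ R →
        b * G.c u v + C v ≤ b * G.c u w + C w)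

/-- The graph, restricted to the edges `E'`, is traversable for reward `R`:
the source is motivated. -/
def TraversableOn {n : ℕ} (G : PlanningInstance n)
    (E' : Fin n → Fin n → Prop) (b R : ℝ) : Prop :=
  ∃ M C, RewardSpecOn G E' b R M C ∧ M G.s

/-- `R^min(G)`: the minimal (nonnegative) reward at `t` for which `G` is
traversable by the sophisticated agent. -/
noncomputable def Rmin {n : ℕ} (G : PlanningInstance n) (b : ℝ) : ℝ :=
  sInf {R : ℝ | 0 ≤ R ∧ TraversableOn G G.E b R}

/-- `R_d(G)`: the minimal reward for which some subgraph of `G` is traversable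
(i.e. the minimum of `R^min` over subgraphs obtained by deleting edges). -/
noncomputable def Rdel {n : ℕ} (G : PlanningInstance n) (b : ℝ) : ℝ :=
  sInf {R : ℝ | 0 ≤ R ∧ ∃ E' : Fin n → Fin n → Prop,
    (∀ u v, E' u v → G.E u v) ∧ TraversableOn G E' b R}

theorem pathCost_nonneg {n : ℕ} (G : PlanningInstance n) {t : Fin n} :
    ∀ (l : List (Fin n)) (u : Fin n), IsPathTo G.E t u l → 0 ≤ pathCost G.c u l
  | [], _, _ => le_rfl
  | v :: l, u, h => add_nonneg (G.c_nonneg u v h.1) (pathCost_nonneg G l v h.2)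

/-- A reward of at least `b` times the cost of a path motivates its first node, whose pruned
sophisticated cost is then at most `b` times the cost of the path. -/
theorem RewardSpecOn.motivated_of_path {n : ℕ} {G : PlanningInstance n} {b R : ℝ}
    {M : Fin n → Prop} {C : Fin n → ℝ} (h : RewardSpecOn G G.E b R M C) (hb : 1 ≤ b) :
    ∀ (l : List (Fin n)) (u : Fin n), IsPathTo G.E G.t u l → b * pathCost G.c u l ≤ R →
      M u ∧ C u ≤ b * pathCost G.c u l := by
  have hb0 : 0 ≤ b := zero_le_one.trans hb
  intro l
  induction l with
  | nil =>
    rintro u rfl -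
    exact ⟨h.m_t, by simp [pathCost, h.c_t]⟩
  | cons v l ih =>
    intro u hp hR
    by_cases hut : u = G.t
    · subst hut
      exact ⟨h.m_t, h.c_t ▸ mul_nonneg hb0 (pathCost_nonneg G _ _ hp)⟩
    · simp only [pathCost, mul_add] at hR ⊢
      have hc : 0 ≤ b * G.c u v := mul_nonneg hb0 (G.c_nonneg u v hp.1)
      obtain ⟨hMv, hCv⟩ := ih v hp.2 (by linarith)
      have hle : b * G.c u v + C v ≤ R := by linarith
      have hMu : M u := (h.m_iff u hut).2 ⟨v, hp.1, hMv, hle⟩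
      obtain ⟨w, hw, -, -, hCu, hmin⟩ := h.c_min u hut hMu
      have hwv := hmin v hp.1 hMv hle
      have hcw := le_mul_of_one_le_left (G.c_nonneg u w hw) hb
      exact ⟨hMu, by linarith⟩

/-- The reverse topological recursion has a solution. -/
theorem exists_rewardSpecOn {n : ℕ} (G : PlanningInstance n) (E' : Fin n → Fin n → Prop)
    (hE : ∀ u v, E' u v → u < v) (b R : ℝ) :
    ∃ M C, RewardSpecOn G E' b R M C := by
  classical
  let P : (Fin n → Prop × ℝ) → Fin n → Fin n → Prop := fun g u v =>
    E' u v ∧ (g v).1 ∧ b * G.c u v + (g v).2 ≤ R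
  let Q : (Fin n → Prop × ℝ) → Fin n → Fin n → Prop := fun g u v =>
    P g u v ∧ ∀ w, P g u w → b * G.c u v + (g v).2 ≤ b * G.c u w + (g w).2
  let step : Fin n → (Fin n → Prop × ℝ) → Prop × ℝ := fun u g =>
    (u = G.t ∨ ∃ v, P g u v,
      if u = G.t then 0 else if h : ∃ v, Q g u v then G.c u h.choose + (g h.choose).2 else 0)
  have hwf : WellFounded (fun v u : Fin n => u < v) := wellFounded_gt
  let F : Fin n → Prop × ℝ := hwf.fix fun u f =>
    step u fun v => if h : u < v then f v h else (False, 0)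
  let T : Fin n → Fin n → Prop × ℝ := fun u v => if u < v then F v else (False, 0)
  have hF : ∀ u, F u = step u (T u) := fun u => by
    simp only [F, T]
    rw [hwf.fix_eq]
    rfl
  have hT : ∀ u v, E' u v → T u v = F v := fun u v h => if_pos (hE u v h)
  have hP : ∀ u v, P (T u) u v ↔ P F u v := fun u v => by
    simp only [P]
    refine and_congr_right fun h => ?_
    rw [hT u v h]
  have hM : ∀ u, u ≠ G.t → ((F u).1 ↔ ∃ v, P F u v) := fun u hu => by
    rw [hF u]
    simp only [step, hu, false_or, hP]
  refine ⟨fun u => (F u).1, fun u => (F u).2, ⟨?_, ?_, hM, ?_⟩⟩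
  · rw [hF]
    exact Or.inl rfl
  · rw [hF]
    exact if_pos rfl
  · intro u hu hMu
    have hex : ∃ v, Q (T u) u v := by
      obtain ⟨v, hv⟩ := (hM u hu).1 hMu
      obtain ⟨w, hw, hmin⟩ := Set.exists_min_image {v | P (T u) u v}
        (fun v => b * G.c u v + (T u v).2) (Set.toFinite _) ⟨v, (hP u v).2 hv⟩
      exact ⟨w, hw, hmin⟩
    obtain ⟨hv, hmin⟩ := hex.choose_spec
    have hv' := (hP u _).1 hv
    have hTv := hT u _ hv'.1
    refine ⟨hex.choose, hv'.1, hv'.2.1, hv'.2.2, ?_, fun w hw hMw hle => ?_⟩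
    · rw [← hTv, hF u]
      simp only [step, if_neg hu, dif_pos hex]
    · have hwv := hmin w ((hP u w).2 ⟨hw, hMw, hle⟩)
      rwa [hTv, hT u w hw] at hwv


/-- If the reward placed at `t` satisfies `R ≥ b · C_o(u)`,
then `u` is motivated (never abandoned); in particular `G` is traversable for
every reward `R ≥ b · C_o(s)`, so `R^min(G) ≤ b · C_o(s)`. -/
theorem rmin_at_most_b_times_opt {n : ℕ} (G : PlanningInstance n) (b : ℝ)
    (hb : 1 < b) (Co : Fin n → ℝ) (hCo : IsOptCost G Co) :
    (∀ (R : ℝ) (M : Fin n → Prop) (C : Fin n → ℝ),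
      RewardSpecOn G G.E b R M C → ∀ u, b * Co u ≤ R → M u) ∧
    (∀ R : ℝ, b * Co G.s ≤ R → TraversableOn G G.E b R) ∧
    Rmin G b ≤ b * Co G.s := by
  have hmot : ∀ (R : ℝ) (M : Fin n → Prop) (C : Fin n → ℝ),
      RewardSpecOn G G.E b R M C → ∀ u, b * Co u ≤ R → M u := by
    intro R M C h u hu
    obtain ⟨l, hl, hcost⟩ := (hCo u).1
    exact (h.motivated_of_path hb.le l u hl (hcost ▸ hu)).1
  have htrav : ∀ R : ℝ, b * Co G.s ≤ R → TraversableOn G G.E b R := by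
    intro R hR
    obtain ⟨M, C, h⟩ := exists_rewardSpecOn G G.E G.edge_lt b R
    exact ⟨M, C, h, hmot R M C h G.s hR⟩
  have hnonneg : 0 ≤ Co G.s := by
    obtain ⟨l, hl, hcost⟩ := (hCo G.s).1
    exact hcost ▸ pathCost_nonneg G l G.s hl
  exact ⟨hmot, htrav, csInf_le ⟨0, fun _ hR => hR.1⟩
    ⟨mul_nonneg (zero_le_one.trans hb.le) hnonneg, htrav _ le_rfl⟩⟩
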